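/- arXiv:2303.10153 — 2 statements merged into one kernel-verified Lean document; each statement's English description precedes it below -/
import Mathlib

section
/- Let α, a > 0, 0 ≤ t₀ < T*, and suppose y ∈ C¹([t₀,T*), ℝⁿ) satisfies y ≠ 0, |y(t)| → ∞ as t → T*⁻, and y' = a|y|^α y + f(t) with f continuous and |f(t)| ≤ |y(t)|^{1+α} E₀(t) for integrable E₀ ≥ 0. Then for all t ∈ [t₀, T*): |y(t)|^{−α} = αa(T*−t) + g(t), where g(t) = α∫_t^{T*} |y(τ)|^{−α−2} f(τ)·y(τ) dτ satisfies |g(t)| ≤ α∫_t^{T*} E₀(τ) dτ. -/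
open scoped Topology

open MeasureTheory Set Filter
open scoped RealInnerProductSpace

theorem HasDerivAt.norm_rpow_neg {E : Type*} [NormedAddCommGroup E] [InnerProductSpace ℝ E]
    {y : ℝ → E} {y' : E} {t : ℝ} (α : ℝ) (hy : HasDerivAt y y' t) (h0 : y t ≠ 0) :
    HasDerivAt (fun s => ‖y s‖ ^ (-α)) (-α * (‖y t‖ ^ (-α - 2) * ⟪y', y t⟫)) t := by
  have hpos : 0 < ‖y t‖ := norm_pos_iff.mpr h0
  have h := hy.norm_sq.rpow_const (p := -α / 2) (Or.inl (by positivity))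
  have key : ∀ (x : E) (p : ℝ), (‖x‖ ^ 2) ^ p = ‖x‖ ^ (2 * p) := fun x p => by
    rw [← Real.rpow_natCast_mul (norm_nonneg x)]
    norm_num
  simp only [key] at h
  convert h using 1
  · funext s
    congr 1
    ring
  · rw [real_inner_comm, show 2 * (-α / 2 - 1) = -α - 2 by ring]
    ring

theorem abs_norm_rpow_mul_inner_le {E : Type*} [NormedAddCommGroup E] [InnerProductSpace ℝ E]
    {v w : E} {α e : ℝ} (hv : v ≠ 0) (hw : ‖w‖ ≤ ‖v‖ ^ (1 + α) * e) :
    |‖v‖ ^ (-α - 2) * ⟪w, v⟫| ≤ e := by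
  have hpos : 0 < ‖v‖ := norm_pos_iff.mpr hv
  rw [abs_mul, abs_of_pos (Real.rpow_pos_of_pos hpos _)]
  calc ‖v‖ ^ (-α - 2) * |⟪w, v⟫|
      ≤ ‖v‖ ^ (-α - 2) * (‖v‖ ^ (1 + α) * e * ‖v‖) := by
        gcongr
        exact (abs_real_inner_le_norm w v).trans (by gcongr)
    _ = ‖v‖ ^ (-α - 2) * ‖v‖ ^ (1 + α) * ‖v‖ ^ (1 : ℝ) * e := by
        rw [Real.rpow_one]
        ring
    _ = e := by
        rw [← Real.rpow_add hpos, ← Real.rpow_add hpos]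
        ring_nf
        simp

theorem stmt_13 {n : ℕ} (α a t₀ T : ℝ) (hα : 0 < α) (ha : 0 < a)
    (h0 : 0 ≤ t₀) (hT : t₀ < T)
    (y f : ℝ → EuclideanSpace ℝ (Fin n)) (E₀ : ℝ → ℝ)
    (hycont : ContinuousOn y (Ico t₀ T))
    (hy0 : ∀ t ∈ Ico t₀ T, y t ≠ 0)
    (hblow : Tendsto (fun t => ‖y t‖) (𝓝[<] T) atTop)
    (hode : ∀ t ∈ Ioo t₀ T, HasDerivAt y ((a * ‖y t‖ ^ α) • y t + f t) t)
    (hfcont : ContinuousOn f (Ico t₀ T))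
    (hE0nn : ∀ t ∈ Ico t₀ T, 0 ≤ E₀ t)
    (hfE : ∀ t ∈ Ico t₀ T, ‖f t‖ ≤ ‖y t‖ ^ (1 + α) * E₀ t)
    (hE0int : IntegrableOn E₀ (Ico t₀ T)) :
    ∀ t ∈ Ico t₀ T,
      IntegrableOn (fun τ => ‖y τ‖ ^ (-α - 2) * ⟪f τ, y τ⟫) (Ico t T) ∧
      ‖y t‖ ^ (-α)
        = α * a * (T - t) + α * ∫ τ in Ico t T, ‖y τ‖ ^ (-α - 2) * ⟪f τ, y τ⟫ ∧
      |α * ∫ τ in Ico t T, ‖y τ‖ ^ (-α - 2) * ⟪f τ, y τ⟫|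
        ≤ α * ∫ τ in Ico t T, E₀ τ := by
  intro t ht
  have hsub : Ico t T ⊆ Ico t₀ T := Ico_subset_Ico_left ht.1
  have hE : IntegrableOn E₀ (Ico t T) := hE0int.mono_set hsub
  have hbound : ∀ τ ∈ Ico t T, ‖‖y τ‖ ^ (-α - 2) * ⟪f τ, y τ⟫‖ ≤ E₀ τ := fun τ hτ =>
    abs_norm_rpow_mul_inner_le (hy0 τ (hsub hτ)) (hfE τ (hsub hτ))
  have hcont : ContinuousOn (fun τ => ‖y τ‖ ^ (-α - 2) * ⟪f τ, y τ⟫) (Ico t T) :=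
    ((hycont.mono hsub).norm.rpow_const
      fun τ hτ => Or.inl (norm_ne_zero_iff.mpr (hy0 τ (hsub hτ)))).mul
      ((hfcont.mono hsub).inner (𝕜 := ℝ) (hycont.mono hsub))
  have hae : ∀ᵐ τ ∂volume.restrict (Ico t T), ‖‖y τ‖ ^ (-α - 2) * ⟪f τ, y τ⟫‖ ≤ E₀ τ :=
    (ae_restrict_iff' measurableSet_Ico).mpr (Eventually.of_forall hbound)
  have hint : IntegrableOn (fun τ => ‖y τ‖ ^ (-α - 2) * ⟪f τ, y τ⟫) (Ico t T) :=
    hE.mono' (hcont.aestronglyMeasurable measurableSet_Ico) hae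
  refine ⟨hint, ?_, ?_⟩
  · have hderiv : ∀ τ ∈ Ioo t T, HasDerivAt (fun s => ‖y s‖ ^ (-α))
        (-(α * a) + -α * (‖y τ‖ ^ (-α - 2) * ⟪f τ, y τ⟫)) τ := by
      intro τ hτ
      have hne := hy0 τ (hsub ⟨hτ.1.le, hτ.2⟩)
      have hpos : 0 < ‖y τ‖ := norm_pos_iff.mpr hne
      convert (hode τ ⟨ht.1.trans_lt hτ.1, hτ.2⟩).norm_rpow_neg α hne using 1
      have hone : ‖y τ‖ ^ (-α - 2) * (‖y τ‖ ^ α * ‖y τ‖ ^ 2) = 1 := by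
        rw [← Real.rpow_natCast, ← Real.rpow_add hpos, ← Real.rpow_add hpos]
        norm_num
      rw [inner_add_left, real_inner_smul_left, real_inner_self_eq_norm_sq]
      linear_combination α * a * hone
    have hii : IntervalIntegrable (fun τ => ‖y τ‖ ^ (-α - 2) * ⟪f τ, y τ⟫) volume t T :=
      (intervalIntegrable_iff_integrableOn_Ico_of_le ht.2.le).mpr hint
    have hleft : Tendsto (fun s => ‖y s‖ ^ (-α)) (𝓝[>] t) (𝓝 (‖y t‖ ^ (-α))) := by
      have hc : ContinuousWithinAt (fun s => ‖y s‖ ^ (-α)) (Ico t T) t :=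
        ((hycont.mono hsub) t ⟨le_rfl, ht.2⟩).norm.rpow_const
          (Or.inl (norm_ne_zero_iff.mpr (hy0 t ht)))
      rw [← nhdsWithin_Ioo_eq_nhdsGT ht.2]
      exact hc.mono Ioo_subset_Ico_self
    have hright : Tendsto (fun s => ‖y s‖ ^ (-α)) (𝓝[<] T) (𝓝 0) :=
      (tendsto_rpow_neg_atTop hα).comp hblow
    have hftc := intervalIntegral.integral_eq_sub_of_hasDerivAt_of_tendsto ht.2 hderiv
      (intervalIntegrable_const.add (hii.const_mul (-α))) hleft hright
    rw [intervalIntegral.integral_add intervalIntegrable_const (hii.const_mul (-α)),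
      intervalIntegral.integral_const, intervalIntegral.integral_const_mul,
      intervalIntegral.integral_of_le ht.2.le, ← integral_Ico_eq_integral_Ioc,
      smul_eq_mul] at hftc
    linear_combination hftc
  · rw [abs_mul, abs_of_pos hα]
    gcongr
    exact norm_integral_le_of_norm_le hE hae
end

section
/- Let A be a real diagonalizable n×n matrix with positive eigenvalues, H : ℝⁿ \ {0} → ℝ positively homogeneous of degree α > 0, positive and continuous on the unit sphere, and G : [t₀,∞) × (ℝⁿ \ {0}) → ℝⁿ continuous with |G(t,x)|/|x|^{1+α} → 0 as |x| → ∞ uniformly in t ≥ t₀. Then there exists r₀ > 0 such that every C¹ solution y of y' = H(y)Ay + G(t,y) on a maximal interval [t₀, T_max) with |y(t₀)| ≥ r₀ satisfies T_max < ∞ and |y(t)| → ∞ as t → T_max⁻. -/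
open scoped Topology

open MeasureTheory Set Filter Metric

/-- Tonelli's approximation: a solution of the integral equation with delay `δ`. -/
theorem exists_delayed_solution {E : Type*} [NormedAddCommGroup E] [NormedSpace ℝ E]
    (f : ℝ → E → E) (hf : Continuous fun p : ℝ × E => f p.1 p.2)
    {M : NNReal} (hM : ∀ t x, ‖f t x‖ ≤ M) (T : ℝ) (v : E) {δ : ℝ} (hδ : 0 < δ) :
    ∃ u : ℝ → E, LipschitzWith M u ∧ u T = v ∧
      ∀ t ∈ Icc T (T + 1), u t = v + ∫ s in T..t, f s (u (s - δ)) := by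
  let Φ : (ℝ → E) → ℝ → E := fun u t => v + ∫ s in T..(max t T), f s (u (s - δ))
  let x : ℕ → ℝ → E := fun m => Φ^[m] fun _ => v
  have hx : ∀ m t, x (m + 1) t = v + ∫ s in T..(max t T), f s (x m (s - δ)) := fun m t => by
    simp only [x, Function.iterate_succ_apply', Φ]
  have hlip : ∀ m, LipschitzWith M (x m) := by
    intro m
    induction m with
    | zero => exact (LipschitzWith.const v).weaken (zero_le)
    | succ m ih =>
      have hc : Continuous fun s => f s (x m (s - δ)) :=
        hf.comp (continuous_id.prodMk (ih.continuous.comp (continuous_id.sub continuous_const)))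
      refine LipschitzWith.of_dist_le_mul fun a b => ?_
      rw [hx, hx, dist_add_left, dist_eq_norm, intervalIntegral.integral_interval_sub_left
        (hc.intervalIntegrable _ _) (hc.intervalIntegrable _ _)]
      refine (intervalIntegral.norm_integral_le_of_norm_le_const fun s _ => hM _ _).trans ?_
      gcongr
      rw [Real.dist_eq]
      exact abs_max_sub_max_le_abs a b T
  have hstep : ∀ m : ℕ, ∀ t ≤ T + m * δ, x (m + 1) t = x m t := by
    intro m
    induction m with
    | zero =>
      intro t ht
      rw [hx, max_eq_right (by simpa using ht)]
      simp [x]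
    | succ m ih =>
      intro t ht
      rw [hx, hx]
      congr 1
      refine intervalIntegral.integral_congr fun s hs => ?_
      rw [uIcc_of_le (le_max_right _ _)] at hs
      have h1 : s ≤ T + (m + 1 : ℕ) * δ := hs.2.trans (max_le ht (by simp; positivity))
      push_cast at h1
      rw [ih _ (by linarith)]
  obtain ⟨m, hm⟩ := exists_nat_ge (1 / δ)
  rw [div_le_iff₀ hδ] at hm
  refine ⟨x m, hlip m, ?_, fun t ht => ?_⟩
  · cases m with
    | zero => rfl
    | succ m => simp [hx]
  · rw [← hstep m t (by linarith [ht.2]), hx, max_eq_left ht.1]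

/-- **Peano's existence theorem** for a bounded continuous right-hand side. -/
theorem exists_integral_solution {E : Type*} [NormedAddCommGroup E] [NormedSpace ℝ E]
    [FiniteDimensional ℝ E] (f : ℝ → E → E) (hf : Continuous fun p : ℝ × E => f p.1 p.2)
    {M : NNReal} (hM : ∀ t x, ‖f t x‖ ≤ M) (T : ℝ) (v : E) :
    ∃ u : ℝ → E, LipschitzWith M u ∧ u T = v ∧
      ∀ t ∈ Icc T (T + 1), u t = v + ∫ s in T..t, f s (u s) := by
  have : ProperSpace E := FiniteDimensional.proper ℝ E
  choose u hlip hT hu using fun k : ℕ =>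
    exists_delayed_solution f hf hM T v (δ := 1 / ((k : ℝ) + 1)) (by positivity)
  let S : Set C(ℝ, E) := {w | LipschitzWith M w ∧ w T = v}
  have hS : IsCompact S := by
    refine ArzelaAscoli.isCompact_of_equicontinuous S ?_ ?_
    · have him : ContinuousMap.toFun '' S = {w : ℝ → E | LipschitzWith M w ∧ w T = v} := by
        ext w
        constructor
        · rintro ⟨g, hg, rfl⟩
          exact hg
        · intro hw
          exact ⟨⟨w, hw.1.continuous⟩, hw, rfl⟩
      rw [him]
      refine (isCompact_univ_pi fun t => isCompact_closedBall v (M * dist t T)).of_isClosed_subset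
        ?_ fun w hw t _ => ?_
      · have hset : {w : ℝ → E | LipschitzWith M w} =
            ⋂ a, ⋂ b, {w | dist (w a) (w b) ≤ M * dist a b} := by
          ext w
          simp [lipschitzWith_iff_dist_le_mul]
        refine IsClosed.inter ?_ (isClosed_eq (continuous_apply T) continuous_const)
        change IsClosed {w : ℝ → E | LipschitzWith M w}
        rw [hset]
        exact isClosed_iInter fun a => isClosed_iInter fun b => isClosed_le
          ((continuous_apply a).dist (continuous_apply b)) continuous_const
      · rw [mem_closedBall, ← hw.2]
        exact hw.1.dist_le_mul t T
    · exact (LipschitzWith.uniformEquicontinuous _ M fun w => w.2.1).equicontinuous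
  obtain ⟨w, hw, φ, hφ, hlim⟩ := hS.tendsto_subseq
    (x := fun k => (⟨u k, (hlip k).continuous⟩ : C(ℝ, E)))
    fun k => ⟨hlip k, hT k⟩
  have hpt : ∀ t, Tendsto (fun k => u (φ k) t) atTop (𝓝 (w t)) := fun t =>
    ((continuous_eval_const (F := C(ℝ, E)) t).tendsto w).comp hlim
  have hdel : ∀ s, Tendsto (fun k => u (φ k) (s - 1 / ((φ k : ℝ) + 1))) atTop (𝓝 (w s)) := by
    intro s
    refine (hpt s).congr_dist ?_
    refine squeeze_zero (fun _ => dist_nonneg) (fun k => (hlip (φ k)).dist_le_mul _ _) ?_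
    have h1 := tendsto_one_div_add_atTop_nhds_zero_nat (𝕜 := ℝ) |>.comp hφ.tendsto_atTop
    have h2 := h1.const_mul (M : ℝ)
    rw [mul_zero] at h2
    refine h2.congr fun k => ?_
    simp only [Function.comp, Real.dist_eq, sub_sub_cancel]
    rw [abs_of_nonneg (by positivity)]
  refine ⟨w, hw.1, hw.2, fun t ht => ?_⟩
  refine tendsto_nhds_unique (hpt t) ?_
  simp_rw [fun k => hu (φ k) t ht]
  refine tendsto_const_nhds.add ?_
  refine intervalIntegral.tendsto_integral_filter_of_dominated_convergence (fun _ => (M : ℝ))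
    (.of_forall fun k => ?_) (.of_forall fun k => .of_forall fun s _ => hM _ _)
    intervalIntegrable_const (.of_forall fun s _ => ?_)
  · exact (hf.comp (continuous_id.prodMk ((hlip (φ k)).continuous.comp
      (continuous_id.sub continuous_const)))).aestronglyMeasurable
  · exact (hf.tendsto (s, w s)).comp (tendsto_const_nhds.prodMk_nhds (hdel s))

/-- Local form of Peano's existence theorem. -/
theorem exists_local_solution {E : Type*} [NormedAddCommGroup E] [NormedSpace ℝ E]
    [FiniteDimensional ℝ E] (F : ℝ → E → E) {T : ℝ} {v : E} {r : ℝ} (hr : 0 < r)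
    (hF : ContinuousOn (fun p : ℝ × E => F p.1 p.2) (Icc T (T + 1) ×ˢ closedBall v r)) :
    ∃ δ > 0, ∃ u : ℝ → E, u T = v ∧ ∀ t ∈ Icc T (T + δ),
      u t ∈ closedBall v r ∧ HasDerivAt u (F t (u t)) t := by
  have : ProperSpace E := FiniteDimensional.proper ℝ E
  obtain ⟨C, hC⟩ := (isCompact_Icc.prod (isCompact_closedBall v r)).exists_bound_of_continuousOn hF
  let ρ : ℝ × E → ℝ × E :=
    fun p => (max T (min p.1 (T + 1)), v + (r / max r ‖p.2 - v‖) • (p.2 - v))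
  have hpos : ∀ x : E, 0 < max r ‖x - v‖ := fun x => lt_max_of_lt_left hr
  have hρc : Continuous ρ := by
    have h : Continuous fun p : ℝ × E => r / max r ‖p.2 - v‖ :=
      continuous_const.div (by fun_prop) fun p => (hpos p.2).ne'
    fun_prop
  have hρm : ∀ p, ρ p ∈ Icc T (T + 1) ×ˢ closedBall v r := by
    intro p
    refine ⟨⟨le_max_left _ _, max_le (by linarith) (min_le_right _ _)⟩, ?_⟩
    simp only [ρ, mem_closedBall, dist_self_add_left, norm_smul, norm_div, Real.norm_eq_abs,
      abs_of_pos hr, abs_of_pos (hpos p.2)]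
    rw [div_mul_eq_mul_div, div_le_iff₀ (hpos p.2)]
    gcongr
    exact le_max_right _ _
  have hρid : ∀ p ∈ Icc T (T + 1) ×ˢ closedBall v r, ρ p = p := by
    rintro ⟨t, x⟩ ⟨ht, hx⟩
    have h1 : ‖x - v‖ ≤ r := by simpa [dist_eq_norm] using hx
    simp only [ρ, min_eq_left ht.2, max_eq_right ht.1, max_eq_left h1, div_self hr.ne', one_smul,
      add_sub_cancel]
  have hfc : Continuous fun p : ℝ × E => F (ρ p).1 (ρ p).2 := hF.comp_continuous hρc hρm
  obtain ⟨w, hlip, hT, hw⟩ := exists_integral_solution (fun t x => F (ρ (t, x)).1 (ρ (t, x)).2) hfc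
    (M := C.toNNReal) (fun t x => (hC _ (hρm _)).trans (Real.le_coe_toNNReal C)) T v
  have hgc : Continuous fun s => F (ρ (s, w s)).1 (ρ (s, w s)).2 :=
    hfc.comp (continuous_id.prodMk hlip.continuous)
  have hM : 0 < max C 0 + 1 := by positivity
  refine ⟨min 1 (r / (max C 0 + 1)), by positivity,
    fun t => v + ∫ s in T..t, F (ρ (s, w s)).1 (ρ (s, w s)).2, by simp, fun t ht => ?_⟩
  have ht1 : t ∈ Icc T (T + 1) := ⟨ht.1, ht.2.trans (by gcongr; exact min_le_left _ _)⟩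
  have hb : w t ∈ closedBall v r := by
    rw [mem_closedBall, ← hT]
    refine (hlip.dist_le_mul t T).trans ?_
    rw [Real.dist_eq, abs_of_nonneg (sub_nonneg.2 ht.1)]
    have h2 : t - T ≤ r / (max C 0 + 1) := by
      have := min_le_right 1 (r / (max C 0 + 1))
      linarith [ht.2]
    rw [le_div_iff₀ hM] at h2
    rw [Real.coe_toNNReal']
    nlinarith [ht.1]
  beta_reduce
  rw [← hw t ht1]
  refine ⟨hb, ?_⟩
  have h := (intervalIntegral.integral_hasDerivAt_right (hgc.intervalIntegrable T t)
    (hgc.stronglyMeasurableAtFilter _ _) hgc.continuousAt).const_add v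
  rwa [hρid (t, w t) ⟨ht1, hb⟩] at h

/-- A solution of an ordinary differential equation with continuous right-hand side which stays in
a compact subset of the domain up to a finite time `T` extends beyond `T`. -/
theorem exists_extension_of_mem_compact {E : Type*} [NormedAddCommGroup E] [NormedSpace ℝ E]
    [FiniteDimensional ℝ E] {F : ℝ → E → E} {Ω K : Set E} {t₀ T : ℝ} (hΩ : IsOpen Ω)
    (hF : ContinuousOn (fun p : ℝ × E => F p.1 p.2) (Ici t₀ ×ˢ Ω)) (hK : IsCompact K)
    (hKΩ : K ⊆ Ω) (hT : t₀ < T) {y : ℝ → E} (hyK : ∀ t ∈ Ico t₀ T, y t ∈ K)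
    (hyc : ContinuousOn y (Ico t₀ T)) (hy : ∀ t ∈ Ioo t₀ T, HasDerivAt y (F t (y t)) t) :
    ∃ δ > 0, ∃ z : ℝ → E, (∀ t ∈ Ico t₀ (T + δ), z t ∈ Ω) ∧ ContinuousOn z (Ico t₀ (T + δ)) ∧
      (∀ t ∈ Ioo t₀ (T + δ), HasDerivAt z (F t (z t)) t) ∧ ∀ t ∈ Ico t₀ T, z t = y t := by
  have : CompleteSpace E := FiniteDimensional.complete ℝ E
  obtain ⟨C, hC⟩ := ((isCompact_Icc (a := t₀) (b := T)).prod hK).exists_bound_of_continuousOn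
    (hF.mono (prod_mono (fun t ht => ht.1) hKΩ) :
      ContinuousOn _ (Icc t₀ T ×ˢ K))
  have hlip : LipschitzOnWith C.toNNReal y (Ioo t₀ T) :=
    (convex_Ioo t₀ T).lipschitzOnWith_of_nnnorm_hasDerivWithin_le
      (fun t ht => (hy t ht).hasDerivWithinAt) fun t ht => by
        rw [← NNReal.coe_le_coe]
        exact (hC (t, y t) ⟨Ioo_subset_Icc_self ht, hyK t (Ioo_subset_Ico_self ht)⟩).trans
          (Real.le_coe_toNNReal C)
  have hcau : Cauchy (map y (𝓝[<] T)) := by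
    refine Cauchy.map_of_le (cauchy_nhds.mono nhdsWithin_le_nhds) hlip.uniformContinuousOn ?_
    exact le_principal_iff.2 (Ioo_mem_nhdsLT hT)
  obtain ⟨v, hv⟩ := CompleteSpace.complete hcau
  have hv : Tendsto y (𝓝[<] T) (𝓝 v) := hv
  have hvK : v ∈ K := hK.isClosed.mem_of_tendsto hv
    (by filter_upwards [Ioo_mem_nhdsLT hT] with t ht using hyK t (Ioo_subset_Ico_self ht))
  obtain ⟨r, hr, hrΩ⟩ := Metric.nhds_basis_closedBall.mem_iff.1 (hΩ.mem_nhds (hKΩ hvK))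
  obtain ⟨δ, hδ, u, huT, hu⟩ := exists_local_solution F hr
    (hF.mono (prod_mono (fun t ht => hT.le.trans ht.1) hrΩ) :
      ContinuousOn _ (Icc T (T + 1) ×ˢ closedBall v r))
  let z : ℝ → E := fun t => if t < T then y t else u t
  have hzy : ∀ t < T, z t = y t := fun t ht => if_pos ht
  have hzu : ∀ t, T ≤ t → z t = u t := fun t ht => if_neg ht.not_gt
  have hzT : z T = v := (hzu T le_rfl).trans huT
  have hzlt : ∀ t < T, z =ᶠ[𝓝 t] y := fun t ht => by
    filter_upwards [Iio_mem_nhds ht] with s hs using hzy s hs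
  have hd : ∀ t ∈ Ioo t₀ (T + δ), HasDerivAt z (F t (z t)) t := by
    intro t ht
    rcases lt_trichotomy t T with h | rfl | h
    · rw [hzy t h]
      exact (hy t ⟨ht.1, h⟩).congr_of_eventuallyEq (hzlt t h)
    · have hleft : HasDerivWithinAt z (F t (z t)) (Iic t) t := by
        have hm := Ioo_mem_nhdsLT hT
        have hlim : Tendsto z (𝓝[<] t) (𝓝 v) := hv.congr' <| by
          filter_upwards [self_mem_nhdsWithin] with s hs using (hzy s hs).symm
        refine hasDerivWithinAt_Iic_of_tendsto_deriv (s := Ioo t₀ t) ?_ ?_ hm ?_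
        · intro s hs
          exact ((hy s hs).congr_of_eventuallyEq
            (hzlt s hs.2)).differentiableAt.differentiableWithinAt
        · rw [ContinuousWithinAt, hzT]
          exact hlim.mono_left (nhdsWithin_mono _ fun s hs => hs.2)
        · rw [hzT]
          have h1 : Tendsto (fun s => F s (y s)) (𝓝[<] t) (𝓝 (F t v)) := by
            refine (hF (t, v) ⟨hT.le, hKΩ hvK⟩).tendsto.comp (f := fun s => (s, y s))
              (tendsto_nhdsWithin_iff.2 ⟨?_, ?_⟩)
            · exact (tendsto_id.mono_left nhdsWithin_le_nhds).prodMk_nhds hv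
            · filter_upwards [hm] with s hs
              exact ⟨hs.1.le, hKΩ (hyK s (Ioo_subset_Ico_self hs))⟩
          refine h1.congr' ?_
          filter_upwards [hm] with s hs
          exact ((hy s hs).congr_of_eventuallyEq (hzlt s hs.2)).deriv.symm
      have hright : HasDerivWithinAt z (F t (z t)) (Ici t) t := by
        rw [hzu t le_rfl]
        exact (hu t ⟨le_rfl, by linarith⟩).2.hasDerivWithinAt.congr
          (fun s hs => hzu s hs) (hzu t le_rfl)
      have := hleft.union hright
      rwa [Iic_union_Ici, hasDerivWithinAt_univ] at this
    · rw [hzu t h.le]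
      refine (hu t ⟨h.le, ht.2.le⟩).2.congr_of_eventuallyEq ?_
      filter_upwards [Ioi_mem_nhds h] with s hs using hzu s (le_of_lt hs)
  refine ⟨δ, hδ, z, fun t ht => ?_, fun t ht => ?_, hd, fun t ht => hzy t ht.2⟩
  · rcases lt_or_ge t T with h | h
    · rw [hzy t h]
      exact hKΩ (hyK t ⟨ht.1, h⟩)
    · rw [hzu t h]
      exact hrΩ (hu t ⟨h, ht.2.le⟩).1
  · rcases ht.1.eq_or_lt with rfl | h
    · have h1 : ContinuousWithinAt y (Ici t₀) t₀ :=
        (hyc t₀ ⟨le_rfl, hT⟩).mono_of_mem_nhdsWithin (Ico_mem_nhdsGE hT)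
      exact (h1.congr_of_eventuallyEq ((hzlt t₀ hT).filter_mono nhdsWithin_le_nhds)
        (hzy t₀ hT)).mono fun s hs => hs.1
    · exact (hd t ⟨h, ht.2⟩).continuousAt.continuousWithinAt

/-- If `W' ≥ c W ^ (1 + p)` holds as long as `W > w`, and `W` starts above `w ≥ 0`, then `W` is
monotone and has a finite lifespan. -/
theorem monotoneOn_and_lt_top_of_superlinear {W W' : ℝ → ℝ} {t₀ c p w : ℝ} {Tmax : EReal}
    (hc : 0 < c) (hp : 0 < p) (hw : 0 ≤ w) (hw₀ : w < W t₀)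
    (hWc : ContinuousOn W {t : ℝ | t₀ ≤ t ∧ (t : EReal) < Tmax})
    (hW : ∀ t : ℝ, t₀ < t → (t : EReal) < Tmax → HasDerivAt W (W' t) t)
    (hW' : ∀ t : ℝ, t₀ < t → (t : EReal) < Tmax → w < W t → c * W t ^ (1 + p) ≤ W' t) :
    MonotoneOn W {t : ℝ | t₀ ≤ t ∧ (t : EReal) < Tmax} ∧ Tmax < ⊤ := by
  set I : Set ℝ := {t : ℝ | t₀ ≤ t ∧ (t : EReal) < Tmax} with hI
  have hIcc : ∀ t ∈ I, Icc t₀ t ⊆ I := fun t ht s hs =>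
    ⟨hs.1, (EReal.coe_le_coe_iff.2 hs.2).trans_lt ht.2⟩
  have hmono : ∀ a b, a ∈ I → b ∈ I → a ≤ b → (∀ t ∈ Icc a b, w < W t) →
      MonotoneOn W (Icc a b) := by
    intro a b ha hb hab h
    have hsub : Icc a b ⊆ I := fun s hs => hIcc b hb ⟨ha.1.trans hs.1, hs.2⟩
    have hd : ∀ t ∈ Ioo a b, HasDerivAt W (W' t) t := fun t ht =>
      hW t (ha.1.trans_lt ht.1) (hsub (Ioo_subset_Icc_self ht)).2
    refine monotoneOn_of_deriv_nonneg (convex_Icc a b) (hWc.mono hsub) ?_ ?_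
    · rw [interior_Icc]
      exact fun t ht => (hd t ht).differentiableAt.differentiableWithinAt
    · rw [interior_Icc]
      intro t ht
      rw [(hd t ht).deriv]
      have h0 := h t (Ioo_subset_Icc_self ht)
      have h1 : 0 < W t := hw.trans_lt h0
      exact (by positivity : 0 ≤ c * W t ^ (1 + p)).trans
        (hW' t (ha.1.trans_lt ht.1) (hsub (Ioo_subset_Icc_self ht)).2 h0)
  have hge : ∀ b ∈ I, W t₀ ≤ W b := by
    intro b hb
    have hcb : ContinuousOn W (Icc t₀ b) := hWc.mono (hIcc b hb)
    have hcl : IsClosed ({t | W t₀ ≤ W t} ∩ Icc t₀ b) := by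
      rw [inter_comm]
      exact hcb.preimage_isClosed_of_isClosed isClosed_Icc isClosed_Ici
    refine hcl.Icc_subset_of_forall_exists_gt (le_refl (W t₀)) ?_ ⟨hb.1, le_rfl⟩
    rintro x ⟨hx : W t₀ ≤ W x, hxb⟩ y hy
    have hev : ∀ᶠ t in 𝓝[≥] x, w < W t := by
      have h1 : ContinuousWithinAt W (Ici x) x :=
        ((hcb x ⟨hxb.1, hxb.2.le⟩).mono (Icc_subset_Icc_left hxb.1)).mono_of_mem_nhdsWithin
          (Icc_mem_nhdsGE hxb.2)
      exact h1.eventually_const_lt (hw₀.trans_le hx)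
    obtain ⟨z, hz, hsub⟩ := mem_nhdsGE_iff_exists_Icc_subset.1 hev
    have hm : x < min z (min y b) := lt_min hz (lt_min hy hxb.2)
    have hxI : x ∈ I := hIcc b hb ⟨hxb.1, hxb.2.le⟩
    have hmb : min z (min y b) ≤ b := (min_le_right _ _).trans (min_le_right _ _)
    have hmI : min z (min y b) ∈ I := hIcc b hb ⟨hxb.1.trans hm.le, hmb⟩
    refine ⟨min z (min y b), ?_, hm, (min_le_right _ _).trans (min_le_left _ _)⟩
    exact hx.trans (hmono x _ hxI hmI hm.le
      (fun t ht => hsub ⟨ht.1, ht.2.trans (min_le_left _ _)⟩) ⟨le_rfl, hm.le⟩ ⟨hm.le, le_rfl⟩ hm.le)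
  refine ⟨fun a ha b hb hab => hmono a b ha hb hab (fun t ht => hw₀.trans_le
    (hge t (hIcc b hb ⟨ha.1.trans ht.1, ht.2⟩))) ⟨le_rfl, hab⟩ ⟨hab, le_rfl⟩ hab, ?_⟩
  by_contra htop
  have htop : ∀ t : ℝ, (t : EReal) < Tmax := fun t => by
    rw [not_lt_top_iff.1 htop]
    exact EReal.coe_lt_top t
  have hpos : ∀ t, t₀ ≤ t → 0 < W t := fun t ht =>
    hw.trans_lt (hw₀.trans_le (hge t ⟨ht, htop t⟩))
  have hd : ∀ t, t₀ < t → HasDerivAt (fun t => W t ^ (-p) + p * c * t)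
      (W' t * (-p) * W t ^ (-p - 1) + p * c * 1) t := fun t ht =>
    ((hW t ht (htop t)).rpow_const (Or.inl (hpos t ht.le).ne')).add
      ((hasDerivAt_id t).const_mul (p * c))
  have hanti : AntitoneOn (fun t => W t ^ (-p) + p * c * t) (Ici t₀) := by
    refine antitoneOn_of_deriv_nonpos (convex_Ici t₀) ?_ ?_ ?_
    · refine ContinuousOn.add ?_ (by fun_prop)
      exact (hWc.mono fun t ht => ⟨ht, htop t⟩).rpow_const fun t ht => Or.inl (hpos t ht).ne'
    · rw [interior_Ici]
      exact fun t ht => (hd t ht).differentiableAt.differentiableWithinAt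
    · rw [interior_Ici]
      intro t ht
      have h0 := hpos t (le_of_lt ht)
      rw [(hd t ht).deriv]
      have h1 := hW' t ht (htop t) (hw₀.trans_le (hge t ⟨le_of_lt ht, htop t⟩))
      have h2 : W t ^ (1 + p) * W t ^ (-p - 1) = 1 := by
        rw [← Real.rpow_add h0]
        ring_nf
        exact Real.rpow_zero _
      have h3 : 0 < W t ^ (-p - 1) := by positivity
      have h4 : c * W t ^ (1 + p) * W t ^ (-p - 1) ≤ W' t * W t ^ (-p - 1) := by gcongr
      rw [mul_assoc, h2, mul_one] at h4
      nlinarith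
  have hpc : 0 < p * c := by positivity
  have h0 : 0 < W t₀ ^ (-p) / (p * c) := by
    have := hpos t₀ le_rfl
    positivity
  have h1 := hanti (self_mem_Ici (a := t₀))
    (by simpa using h0.le : t₀ + W t₀ ^ (-p) / (p * c) ∈ Ici t₀)
    (by linarith)
  have h2 : 0 < W (t₀ + W t₀ ^ (-p) / (p * c)) ^ (-p) :=
    Real.rpow_pos_of_pos (hpos _ (by linarith)) _
  have h3 : p * c * (t₀ + W t₀ ^ (-p) / (p * c)) = p * c * t₀ + W t₀ ^ (-p) := by
    field_simp
  simp only [h3] at h1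
  linarith

/-- The growth rate of `‖L x‖ ^ 2` along the flow of `h • A x + g`. -/
theorem le_two_mul_inner_of_small_perturbation {E : Type*} [NormedAddCommGroup E]
    [InnerProductSpace ℝ E] {L : E →L[ℝ] E} {x a g : E} {h h₀ l m q α : ℝ} (hh₀ : 0 < h₀)
    (hl : 0 < l) (hm : 0 < m) (hq : 0 < q) (hα : 0 < α) (hLm : ∀ x, ‖L x‖ ≤ m * ‖x‖)
    (hLq : ‖x‖ ≤ q * ‖L x‖) (hx : x ≠ 0) (hh : h₀ * ‖x‖ ^ α ≤ h)
    (ha : l * ‖L x‖ ^ 2 ≤ inner ℝ (L x) (L a))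
    (hg : ‖g‖ ≤ h₀ * l / (2 * m * q) * ‖x‖ ^ (1 + α)) :
    h₀ * l / m ^ α * (‖L x‖ ^ 2) ^ (1 + α / 2) ≤ 2 * inner ℝ (L x) (L (h • a + g)) := by
  have hx0 : 0 < ‖x‖ := norm_pos_iff.2 hx
  have hL0 : 0 < ‖L x‖ := by
    by_contra! hcon
    nlinarith
  have h1 : h₀ * ‖x‖ ^ α * (l * ‖L x‖ ^ 2) ≤ h * inner ℝ (L x) (L a) := by
    gcongr
    exact (by positivity : 0 ≤ h₀ * ‖x‖ ^ α).trans hh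
  have h2 : -(‖L x‖ * (m * ‖g‖)) ≤ inner ℝ (L x) (L g) := by
    have h3 := abs_real_inner_le_norm (L x) (L g)
    have h4 : ‖L x‖ * ‖L g‖ ≤ ‖L x‖ * (m * ‖g‖) := by
      gcongr
      exact hLm g
    linarith [neg_abs_le (inner ℝ (L x) (L g))]
  have h3 : ‖L x‖ * (m * ‖g‖) ≤ h₀ * l / 2 * ‖x‖ ^ α * ‖L x‖ ^ 2 := by
    calc ‖L x‖ * (m * ‖g‖)
        ≤ ‖L x‖ * (m * (h₀ * l / (2 * m * q) * (q * ‖L x‖ * ‖x‖ ^ α))) := by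
          rw [Real.rpow_add hx0, Real.rpow_one] at hg
          gcongr
          exact hg.trans (by gcongr)
      _ = _ := by field_simp
  have h4 : (‖L x‖ ^ 2) ^ (1 + α / 2) = ‖L x‖ ^ α * ‖L x‖ ^ 2 := by
    rw [← Real.rpow_natCast, ← Real.rpow_mul hL0.le, ← Real.rpow_add hL0]
    congr 1
    push_cast
    ring
  have h5 : ‖L x‖ ^ α ≤ m ^ α * ‖x‖ ^ α := by
    rw [← Real.mul_rpow hm.le hx0.le]
    exact Real.rpow_le_rpow hL0.le (hLm x) hα.le
  have h6 : h₀ * l / m ^ α * (‖L x‖ ^ 2) ^ (1 + α / 2) ≤ h₀ * l * ‖x‖ ^ α * ‖L x‖ ^ 2 := by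
    have hmα : 0 < m ^ α := by positivity
    calc _ ≤ h₀ * l / m ^ α * (m ^ α * ‖x‖ ^ α * ‖L x‖ ^ 2) := by
          rw [h4]
          gcongr
      _ = _ := by field_simp
  rw [map_add, map_smul, inner_add_right, real_inner_smul_right]
  linarith

theorem exists_pos_forall_le_of_finite {ι : Type*} [Finite ι] {f : ι → ℝ} (hf : ∀ i, 0 < f i) :
    ∃ l > 0, ∀ i, l ≤ f i := by
  rcases isEmpty_or_nonempty ι with h | h
  · exact ⟨1, one_pos, fun i => h.elim i⟩
  · obtain ⟨i, hi⟩ := Finite.exists_min f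
    exact ⟨f i, hf i, hi⟩

theorem inner_toEuclideanCLM_diagonal_ge {ι : Type*} [Fintype ι] [DecidableEq ι] {Λ : ι → ℝ}
    {l : ℝ} (h : ∀ i, l ≤ Λ i) (x : EuclideanSpace ℝ ι) :
    l * ‖x‖ ^ 2 ≤ inner ℝ x (Matrix.toEuclideanCLM (𝕜 := ℝ) (Matrix.diagonal Λ) x) := by
  rw [Matrix.inner_toEuclideanCLM, EuclideanSpace.real_norm_sq_eq, Finset.mul_sum, dotProduct]
  refine Finset.sum_le_sum fun i _ => ?_
  rw [Matrix.mulVec_diagonal]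
  nlinarith [h i, sq_nonneg (x i)]

section Homogeneous

variable {E : Type*} [NormedAddCommGroup E] [NormedSpace ℝ E] {H : E → ℝ} {α : ℝ}

theorem eq_norm_rpow_mul_of_homogeneous
    (hhom : ∀ c : ℝ, 0 < c → ∀ x : E, x ≠ 0 → H (c • x) = c ^ α * H x) {x : E} (hx : x ≠ 0) :
    H x = ‖x‖ ^ α * H (‖x‖⁻¹ • x) := by
  have h0 : 0 < ‖x‖ := norm_pos_iff.2 hx
  rw [← hhom ‖x‖ h0 _ (smul_ne_zero (inv_ne_zero h0.ne') hx), smul_inv_smul₀ h0.ne']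

theorem inv_norm_smul_mem_sphere {x : E} (hx : x ≠ 0) : ‖x‖⁻¹ • x ∈ sphere (0 : E) 1 := by
  rw [mem_sphere_zero_iff_norm, norm_smul, norm_inv, norm_norm,
    inv_mul_cancel₀ (norm_ne_zero_iff.2 hx)]

theorem continuousOn_of_homogeneous
    (hhom : ∀ c : ℝ, 0 < c → ∀ x : E, x ≠ 0 → H (c • x) = c ^ α * H x)
    (hcont : ContinuousOn H (sphere 0 1)) : ContinuousOn H {0}ᶜ := by
  have h : ContinuousOn (fun x => ‖x‖ ^ α * H (‖x‖⁻¹ • x)) {0}ᶜ := by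
    have hn : ∀ x ∈ ({0}ᶜ : Set E), ‖x‖ ≠ 0 := fun x hx => norm_ne_zero_iff.2 hx
    refine ContinuousOn.mul (continuous_norm.continuousOn.rpow_const fun x hx => Or.inl (hn x hx))
      (hcont.comp ((continuous_norm.continuousOn.inv₀ hn).smul continuousOn_id)
        fun x hx => inv_norm_smul_mem_sphere hx)
  exact h.congr fun x hx => eq_norm_rpow_mul_of_homogeneous hhom hx

theorem exists_lower_bound_of_homogeneous [FiniteDimensional ℝ E]
    (hhom : ∀ c : ℝ, 0 < c → ∀ x : E, x ≠ 0 → H (c • x) = c ^ α * H x)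
    (hpos : ∀ x ∈ sphere (0 : E) 1, 0 < H x) (hcont : ContinuousOn H (sphere 0 1)) :
    ∃ h₀ > 0, ∀ x ≠ 0, h₀ * ‖x‖ ^ α ≤ H x := by
  have : ProperSpace E := FiniteDimensional.proper ℝ E
  obtain ⟨h₀, h₀pos, hle⟩ : ∃ h₀ > 0, ∀ x ∈ sphere (0 : E) 1, h₀ ≤ H x := by
    rcases (sphere (0 : E) 1).eq_empty_or_nonempty with h | h
    · exact ⟨1, one_pos, by simp [h]⟩
    · obtain ⟨x, hx, hmin⟩ := (isCompact_sphere (0 : E) 1).exists_isMinOn h hcont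
      exact ⟨H x, hpos x hx, fun y hy => hmin hy⟩
  refine ⟨h₀, h₀pos, fun x hx => ?_⟩
  rw [eq_norm_rpow_mul_of_homogeneous hhom hx, mul_comm]
  gcongr
  exact hle _ (inv_norm_smul_mem_sphere hx)

end Homogeneous

theorem stmt_19 {n : ℕ}
    (A : Matrix (Fin n) (Fin n) ℝ)
    (hA : ∃ S : Matrix (Fin n) (Fin n) ℝ, IsUnit S.det ∧
      ∃ Λ : Fin n → ℝ, (∀ i, 0 < Λ i) ∧ A = S⁻¹ * Matrix.diagonal Λ * S)
    (α : ℝ) (hα : 0 < α)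
    (H : EuclideanSpace ℝ (Fin n) → ℝ)
    (hhom : ∀ (c : ℝ), 0 < c → ∀ x : EuclideanSpace ℝ (Fin n), x ≠ 0 →
      H (c • x) = c ^ α * H x)
    (hpos : ∀ x ∈ sphere (0 : EuclideanSpace ℝ (Fin n)) 1, 0 < H x)
    (hcont : ContinuousOn H (sphere (0 : EuclideanSpace ℝ (Fin n)) 1))
    (t₀ : ℝ) (ht₀ : 0 ≤ t₀)
    (G : ℝ → EuclideanSpace ℝ (Fin n) → EuclideanSpace ℝ (Fin n))
    (hGcont : ContinuousOn (fun p : ℝ × EuclideanSpace ℝ (Fin n) => G p.1 p.2)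
      {p : ℝ × EuclideanSpace ℝ (Fin n) | t₀ ≤ p.1 ∧ p.2 ≠ 0})
    (hGsmall : ∀ ε > (0:ℝ), ∃ R > (0:ℝ), ∀ t : ℝ, t₀ ≤ t →
      ∀ x : EuclideanSpace ℝ (Fin n), R ≤ ‖x‖ → ‖G t x‖ ≤ ε * ‖x‖ ^ (1 + α)) :
    ∃ r₀ > (0:ℝ), ∀ (y : ℝ → EuclideanSpace ℝ (Fin n)) (Tmax : EReal),
      (t₀ : EReal) < Tmax →
      r₀ ≤ ‖y t₀‖ →
      (∀ t : ℝ, t₀ ≤ t → (t : EReal) < Tmax → y t ≠ 0) →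
      ContinuousOn y {t : ℝ | t₀ ≤ t ∧ (t : EReal) < Tmax} →
      (∀ t : ℝ, t₀ < t → (t : EReal) < Tmax →
        HasDerivAt y (H (y t) • (Matrix.toEuclideanLin A (y t)) + G t (y t)) t) →
      (∀ T' : EReal, Tmax < T' →
        ¬ ∃ z : ℝ → EuclideanSpace ℝ (Fin n),
          (∀ t : ℝ, t₀ ≤ t → (t : EReal) < T' → z t ≠ 0) ∧
          ContinuousOn z {t : ℝ | t₀ ≤ t ∧ (t : EReal) < T'} ∧
          (∀ t : ℝ, t₀ < t → (t : EReal) < T' →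
            HasDerivAt z (H (z t) • (Matrix.toEuclideanLin A (z t)) + G t (z t)) t) ∧
          (∀ t : ℝ, t₀ ≤ t → (t : EReal) < Tmax → z t = y t)) →
      Tmax < ⊤ ∧ Tendsto (fun t => ‖y t‖) (𝓝[<] Tmax.toReal) atTop := by
  obtain ⟨S, hS, Λ, hΛ, rfl⟩ := hA
  obtain ⟨l, hl, hlΛ⟩ := exists_pos_forall_le_of_finite hΛ
  obtain ⟨h₀, hh₀, hH⟩ := exists_lower_bound_of_homogeneous hhom hpos hcont
  set A := S⁻¹ * Matrix.diagonal Λ * S with hA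
  set L := Matrix.toEuclideanCLM (n := Fin n) (𝕜 := ℝ) S with hL
  set L' := Matrix.toEuclideanCLM (n := Fin n) (𝕜 := ℝ) S⁻¹ with hL'
  set m := ‖L‖ + 1 with hm
  set q := ‖L'‖ + 1 with hq
  have hm0 : 0 < m := by positivity
  have hq0 : 0 < q := by positivity
  have hLm : ∀ x, ‖L x‖ ≤ m * ‖x‖ := fun x => (L.le_opNorm x).trans (by gcongr; linarith)
  have hLq : ∀ x, ‖x‖ ≤ q * ‖L x‖ := fun x => by
    have h1 : L' (L x) = x := by
      rw [← mul_apply_eq_comp, hL, hL', ← map_mul, Matrix.nonsing_inv_mul S hS,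
        map_one, one_apply_eq_self]
    calc ‖x‖ = ‖L' (L x)‖ := by rw [h1]
      _ ≤ ‖L'‖ * ‖L x‖ := L'.le_opNorm _
      _ ≤ q * ‖L x‖ := by gcongr; linarith
  have hinner : ∀ x, l * ‖L x‖ ^ 2 ≤ inner ℝ (L x) (L (Matrix.toEuclideanLin A x)) := fun x => by
    have h1 : L (Matrix.toEuclideanLin A x) =
        Matrix.toEuclideanCLM (𝕜 := ℝ) (Matrix.diagonal Λ) (L x) := by
      rw [← Matrix.coe_toEuclideanCLM_eq_toEuclideanLin, ContinuousLinearMap.coe_coe, hL,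
        ← mul_apply_eq_comp, ← mul_apply_eq_comp, ← map_mul, ← map_mul, hA,
        mul_assoc S⁻¹, Matrix.mul_nonsing_inv_cancel_left S _ hS]
    rw [h1]
    exact inner_toEuclideanCLM_diagonal_ge hlΛ (L x)
  obtain ⟨R, hR, hG⟩ := hGsmall (h₀ * l / (2 * m * q)) (by positivity)
  refine ⟨q * (m * R + 1), by positivity, fun y Tmax hT hy₀ hyne hyc hyd hmax => ?_⟩
  have hRy : ∀ x, (m * R) ^ 2 < ‖L x‖ ^ 2 → R < ‖x‖ := fun x hx => by
    have h1 := lt_of_pow_lt_pow_left₀ 2 (norm_nonneg _) hx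
    exact lt_of_mul_lt_mul_left (h1.trans_le (hLm x)) hm0.le
  have hstart : (m * R) ^ 2 < ‖L (y t₀)‖ ^ 2 := by
    have h1 := le_of_mul_le_mul_left (hy₀.trans (hLq _)) hq0
    exact pow_lt_pow_left₀ (by linarith) (by positivity) two_ne_zero
  obtain ⟨hmono, htop⟩ := monotoneOn_and_lt_top_of_superlinear (W := fun t => ‖L (y t)‖ ^ 2)
    (c := h₀ * l / m ^ α) (p := α / 2) (by positivity) (by positivity) (sq_nonneg (m * R)) hstart
    ((L.continuous.comp_continuousOn hyc).norm.pow 2)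
    (fun t h1 h2 => (L.hasFDerivAt.comp_hasDerivAt t (hyd t h1 h2)).norm_sq)
    (fun t h1 h2 hw => le_two_mul_inner_of_small_perturbation hh₀ hl hm0 hq0 hα hLm (hLq _)
      (hyne t h1.le h2) (hH _ (hyne t h1.le h2)) (hinner _) (hG t h1.le _ (hRy _ hw).le))
  refine ⟨htop, ?_⟩
  lift Tmax to ℝ using ⟨htop.ne, (bot_le.trans_lt hT).ne'⟩ with T
  simp only [EReal.coe_lt_coe_iff, EReal.toReal_coe] at *
  by_contra hnot
  obtain ⟨C, hC⟩ : ∃ C, ∀ t ∈ Ico t₀ T, ‖y t‖ ≤ C := by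
    simp only [Filter.tendsto_atTop, not_forall] at hnot
    obtain ⟨b, hb⟩ := hnot
    refine ⟨q * (m * b), fun t ht => ?_⟩
    obtain ⟨s, hs, hts, hsT⟩ := ((not_eventually.1 hb).and_eventually
      (Ioo_mem_nhdsLT ht.2)).exists
    have h1 : ‖L (y t)‖ ≤ ‖L (y s)‖ :=
      le_of_sq_le_sq (hmono ht ⟨ht.1.trans hts.le, hsT⟩ hts.le) (norm_nonneg _)
    calc ‖y t‖ ≤ q * ‖L (y t)‖ := hLq _
      _ ≤ q * (m * ‖y s‖) := by gcongr; exact h1.trans (hLm _)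
      _ ≤ q * (m * b) := by gcongr; exact (not_le.1 hs).le
  let K : Set (EuclideanSpace ℝ (Fin n)) := closedBall 0 C ∩ {x | R ≤ ‖x‖}
  have hF : ContinuousOn (fun p : ℝ × EuclideanSpace ℝ (Fin n) =>
      H p.2 • Matrix.toEuclideanLin A p.2 + G p.1 p.2) (Ici t₀ ×ˢ {0}ᶜ) := by
    refine ContinuousOn.add (ContinuousOn.fun_smul ?_ ?_) hGcont
    · exact (continuousOn_of_homogeneous hhom hcont).comp continuousOn_snd fun p hp => hp.2
    · exact ((Matrix.toEuclideanLin A).continuous_of_finiteDimensional.comp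
        continuous_snd).continuousOn
  obtain ⟨δ, hδ, z, hz0, hzc, hzd, hzy⟩ := exists_extension_of_mem_compact
    (F := fun t x => H x • Matrix.toEuclideanLin A x + G t x) (K := K)
    isOpen_compl_singleton hF
    ((isCompact_closedBall 0 C).inter_right (isClosed_le continuous_const continuous_norm))
    (fun x hx => norm_pos_iff.1 (hR.trans_le hx.2)) hT
    (fun t ht => ⟨mem_closedBall_zero_iff.2 (hC t ht),
      (hRy _ (hstart.trans_le (hmono ⟨le_rfl, hT⟩ ht ht.1))).le⟩)
    hyc (fun t ht => hyd t ht.1 ht.2)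
  refine hmax (T + δ : ℝ) (EReal.coe_lt_coe_iff.2 (by linarith)) ⟨z, ?_⟩
  simp only [EReal.coe_lt_coe_iff]
  exact ⟨fun t h1 h2 => hz0 t ⟨h1, h2⟩, hzc, fun t h1 h2 => hzd t ⟨h1, h2⟩,
    fun t h1 h2 => hzy t ⟨h1, h2⟩⟩
end
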